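/- arXiv:2304.02474 — 2 statements merged into one kernel-verified Lean document; each statement's English description precedes it below -/
import Mathlib

section
/- ∑_{k=1}^∞ ζ(2k)/(k(2k+3)) = −1/9 + ln(2π)/3 + ζ(3)/(2π²). -/
open Real Complex

lemma aux_logsum (x : ℝ) (hx0 : 0 < x) (hx1 : x < 1) :
    HasSum (fun n : ℕ => -Real.log (1 - x ^ 2 / ((n : ℝ) + 1) ^ 2))
      (Real.log (π * x) - Real.log (Real.sin (π * x))) := by
  have hlt : ∀ n : ℕ, x ^ 2 / ((n : ℝ) + 1) ^ 2 < 1 := by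
    intro n
    rw [div_lt_one (by positivity)]
    have : (0 : ℝ) ≤ n := n.cast_nonneg
    nlinarith
  have hnn : ∀ n : ℕ, 0 ≤ x ^ 2 / ((n : ℝ) + 1) ^ 2 := fun n => by positivity
  rw [hasSum_iff_tendsto_nat_of_nonneg]
  · have hs : 0 < Real.sin (π * x) := by
      apply Real.sin_pos_of_pos_of_lt_pi (by positivity)
      nlinarith [Real.pi_pos]
    have h := (Real.tendsto_euler_sin_prod x).log hs.ne'
    have h2 := (tendsto_const_nhds (x := Real.log (π * x))).sub h
    refine h2.congr ?_
    intro n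
    rw [Real.log_mul (x := π * x) (by positivity), Real.log_prod, Finset.sum_neg_distrib]
    · ring
    · intro i _
      linarith [hlt i]
    · apply Finset.prod_ne_zero_iff.2
      intro i _
      linarith [hlt i]
  · intro n
    have := Real.log_nonpos (x := 1 - x ^ 2 / ((n : ℝ) + 1) ^ 2) (by linarith [hlt n]) (by linarith [hnn n])
    linarith

noncomputable def auxZ (k : ℕ) : ℝ := ∑' n : ℕ, 1 / ((n : ℝ) + 1) ^ (2 * (k + 1))

lemma auxZ_summable (k : ℕ) : Summable (fun n : ℕ => 1 / ((n : ℝ) + 1) ^ (2 * (k + 1))) := by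
  have := (summable_nat_add_iff 1).2 (Real.summable_one_div_nat_pow (p := 2 * (k + 1)).2 (by omega))
  simpa using this

lemma auxZ_nonneg (k : ℕ) : 0 ≤ auxZ k := tsum_nonneg fun n => by positivity

lemma auxZ_le (k : ℕ) : auxZ k ≤ auxZ 0 := by
  refine (auxZ_summable k).tsum_le_tsum (fun n => ?_) (auxZ_summable 0)
  apply one_div_le_one_div_of_le (by positivity)
  apply pow_le_pow_right₀ _ (by omega)
  have : (0 : ℝ) ≤ n := n.cast_nonneg
  linarith

lemma aux_zeta_nat (m : ℕ) (hm : 1 < m) :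
    riemannZeta (m : ℂ) = ((∑' n : ℕ, 1 / (n : ℝ) ^ m : ℝ) : ℂ) := by
  rw [zeta_nat_eq_tsum_of_gt_one hm]
  push_cast
  rfl

lemma auxZ_eq (k : ℕ) : riemannZeta (2 * ((k : ℂ) + 1)) = (auxZ k : ℂ) := by
  have h := aux_zeta_nat (2 * (k + 1)) (by omega)
  have e : ((2 * (k + 1) : ℕ) : ℂ) = 2 * ((k : ℂ) + 1) := by push_cast; ring
  rw [e] at h
  rw [h, auxZ, (Real.summable_one_div_nat_pow.2 (by omega)).tsum_eq_zero_add]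
  simp

lemma aux_series (x : ℝ) (hx0 : 0 < x) (hx1 : x < 1) :
    HasSum (fun k : ℕ => auxZ k * x ^ (2 * (k + 1)) / ((k : ℝ) + 1))
      (Real.log (π * x) - Real.log (Real.sin (π * x))) := by
  have hlt : ∀ n : ℕ, x ^ 2 / ((n : ℝ) + 1) ^ 2 < 1 := by
    intro n
    rw [div_lt_one (by positivity)]
    have : (0 : ℝ) ≤ n := n.cast_nonneg
    nlinarith
  have hnn : ∀ n : ℕ, 0 ≤ x ^ 2 / ((n : ℝ) + 1) ^ 2 := fun n => by positivity
  obtain ⟨f, hfdef⟩ : ∃ f : ℕ × ℕ → ℝ, ∀ p,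
      f p = (x ^ 2 / ((p.1 : ℝ) + 1) ^ 2) ^ (p.2 + 1) / ((p.2 : ℝ) + 1) := ⟨_, fun _ => rfl⟩
  have h1 : ∀ n, HasSum (fun k => f (n, k)) (-Real.log (1 - x ^ 2 / ((n : ℝ) + 1) ^ 2)) := by
    intro n
    have := Real.hasSum_pow_div_log_of_abs_lt_one (x := x ^ 2 / ((n : ℝ) + 1) ^ 2)
      (by rw [abs_of_nonneg (hnn n)]; exact hlt n)
    simpa only [hfdef] using this
  have h0 := aux_logsum x hx0 hx1
  have hf : Summable f := by
    rw [summable_prod_of_nonneg (fun p => by simp only [hfdef, Pi.zero_apply]; positivity)]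
    refine ⟨fun n => (h1 n).summable, ?_⟩
    simp_rw [fun n => (h1 n).tsum_eq]
    exact h0.summable
  have h3 : HasSum f (Real.log (π * x) - Real.log (Real.sin (π * x))) := by
    have := hf.hasSum.prod_fiberwise h1
    rw [h0.unique this]
    exact hf.hasSum
  have h4 := (Equiv.prodComm ℕ ℕ).hasSum_iff.2 h3
  refine h4.prod_fiberwise ?_
  intro k
  have := ((auxZ_summable k).hasSum.mul_right (x ^ (2 * (k + 1)) / ((k : ℝ) + 1)))
  rw [auxZ, mul_div_assoc]
  convert! this using 1
  ext n
  simp only [hfdef, Function.comp, Equiv.prodComm_apply, Prod.swap]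
  rw [div_pow, ← pow_mul, ← pow_mul]
  field_simp

lemma aux_lhs : HasSum (fun k : ℕ => auxZ k / (((k : ℝ) + 1) * (2 * ((k : ℝ) + 1) + 3)))
    (∫ x in (0 : ℝ)..1, x ^ 2 * (Real.log (π * x) - Real.log (Real.sin (π * x)))) := by
  let F : ℕ → ℝ → ℝ := fun k x => x ^ 2 * (auxZ k * x ^ (2 * (k + 1)) / ((k : ℝ) + 1))
  have hint : ∀ k, ∫ x in Set.Ioo (0 : ℝ) 1, F k x
      = auxZ k / (((k : ℝ) + 1) * (2 * ((k : ℝ) + 1) + 3)) := by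
    intro k
    rw [← MeasureTheory.integral_Ioc_eq_integral_Ioo,
      ← intervalIntegral.integral_of_le zero_le_one]
    have : ∀ x, F k x = auxZ k / ((k : ℝ) + 1) * x ^ (2 * (k + 1) + 2) := by
      intro x; simp only [F]; ring
    simp_rw [this]
    rw [intervalIntegral.integral_const_mul, integral_pow]
    push_cast
    simp
    field_simp
    ring
  have hI : ∀ k, MeasureTheory.Integrable (F k)
      (MeasureTheory.volume.restrict (Set.Ioo (0 : ℝ) 1)) := by
    intro k
    have : Continuous (F k) := by fun_prop
    exact (this.integrableOn_Icc (a := 0) (b := 1)).mono_set Set.Ioo_subset_Icc_self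
  have hsum : Summable fun k : ℕ => auxZ k / (((k : ℝ) + 1) * (2 * ((k : ℝ) + 1) + 3)) := by
    refine Summable.of_nonneg_of_le (fun k => ?_) (fun k => ?_) ((auxZ_summable 0).mul_left (auxZ 0))
    · have := auxZ_nonneg k
      positivity
    · rw [← div_eq_mul_one_div]
      have := auxZ_nonneg 0
      apply div_le_div₀ this (auxZ_le k) (by positivity)
      have : (0 : ℝ) ≤ k := k.cast_nonneg
      simp
      nlinarith
  have key := MeasureTheory.hasSum_integral_of_summable_integral_norm hI (by
    convert! hsum using 2 with k
    rw [← hint]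
    congr 1
    ext x
    rw [Real.norm_of_nonneg]
    have := auxZ_nonneg k
    have h2 : 0 ≤ x ^ (2 * (k + 1)) := by rw [pow_mul]; positivity
    simp only [F]
    positivity)
  simp_rw [hint] at key
  rw [intervalIntegral.integral_of_le zero_le_one, MeasureTheory.integral_Ioc_eq_integral_Ioo]
  convert! key using 1
  apply MeasureTheory.setIntegral_congr_fun measurableSet_Ioo
  intro x hx
  exact (((aux_series x hx.1 hx.2).mul_left (x ^ 2)).tsum_eq).symm

lemma aux_intlog : ∫ x in (0 : ℝ)..1, x ^ 2 * Real.log x = - 1 / 9 := by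
  have hc : Continuous fun x : ℝ => x ^ 2 * Real.log x := by
    have := continuous_id.mul Real.continuous_mul_log
    convert! this using 1
    ext x; simp; ring
  have hc3 : Continuous fun x : ℝ => x ^ 3 * Real.log x := by
    have := continuous_id.mul hc
    convert! this using 1
    ext x; simp; ring
  rw [intervalIntegral.integral_eq_sub_of_hasDerivAt_of_le zero_le_one
    (f := fun x => x ^ 3 * Real.log x / 3 - x ^ 3 / 9)]
  · norm_num
  · exact Continuous.continuousOn (by fun_prop)
  · intro x hx
    have hx0 := hx.1.ne'
    have := (((hasDerivAt_pow 3 x).mul (Real.hasDerivAt_log hx0)).div_const 3).sub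
      ((hasDerivAt_pow 3 x).div_const 9)
    convert! this using 1
    field_simp
    simp
    ring
  · exact hc.intervalIntegrable _ _

lemma aux_intcos (n : ℕ) (hn : n ≠ 0) :
    ∫ x in (0 : ℝ)..1, x ^ 2 * Real.cos (2 * π * n * x) = 1 / (2 * π ^ 2 * n ^ 2) := by
  have hn' : (n : ℝ) ≠ 0 := by exact_mod_cast hn
  obtain ⟨a, ha⟩ : ∃ a : ℝ, a = 2 * π * n := ⟨_, rfl⟩
  have ha0 : a ≠ 0 := by rw [ha]; have := Real.pi_pos; positivity
  have hs : Real.sin a = 0 := by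
    have := Real.sin_nat_mul_pi (2 * n)
    rw [ha, ← this]; push_cast; ring_nf
  have hco : Real.cos a = 1 := by
    have := Real.cos_nat_mul_two_pi n
    rw [ha, ← this]; ring_nf
  rw [← ha]
  rw [intervalIntegral.integral_eq_sub_of_hasDerivAt
    (f := fun x => x ^ 2 * Real.sin (a * x) / a + 2 * x * Real.cos (a * x) / a ^ 2
      - 2 * Real.sin (a * x) / a ^ 3)]
  · simp [hs, hco]
    rw [ha]
    field_simp
  · intro x _
    have hl : HasDerivAt (fun x : ℝ => a * x) a x := by simpa using (hasDerivAt_id x).const_mul a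
    have h1 := ((hasDerivAt_pow 2 x).mul hl.sin).div_const a
    have h2 := (((hasDerivAt_id x).const_mul 2).mul hl.cos).div_const (a ^ 2)
    have h3 := (hl.sin.const_mul 2).div_const (a ^ 3)
    convert! (h1.add h2).sub h3 using 1
    field_simp
    simp
    ring
  · exact Continuous.intervalIntegrable (by fun_prop) _ _

lemma aux_normSq (r x : ℝ) : Real.log ‖1 - (r : ℂ) * Complex.exp ((2 * π * x : ℝ) * Complex.I)‖
    = Real.log ((1 - r) ^ 2 + 4 * r * Real.sin (π * x) ^ 2) / 2 := by
  have : ‖1 - (r : ℂ) * Complex.exp ((2 * π * x : ℝ) * Complex.I)‖ ^ 2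
      = (1 - r) ^ 2 + 4 * r * Real.sin (π * x) ^ 2 := by
    rw [← Complex.normSq_eq_norm_sq, Complex.normSq_apply]
    have e1 : (Complex.exp ((2 * π * x : ℝ) * Complex.I)).re = Real.cos (2 * π * x) :=
      Complex.exp_ofReal_mul_I_re _
    have e2 : (Complex.exp ((2 * π * x : ℝ) * Complex.I)).im = Real.sin (2 * π * x) :=
      Complex.exp_ofReal_mul_I_im _
    simp only [Complex.sub_re, Complex.sub_im, Complex.one_re, Complex.one_im,
      Complex.re_ofReal_mul, Complex.im_ofReal_mul, e1, e2]
    have e3 : Real.cos (2 * π * x) = 1 - 2 * Real.sin (π * x) ^ 2 := by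
      rw [mul_assoc, Real.cos_two_mul, Real.cos_sq']; ring
    have e4 := Real.sin_sq_add_cos_sq (2 * π * x)
    have : Real.sin (2 * π * x) ^ 2 = 1 - Real.cos (2 * π * x) ^ 2 := by linarith
    ring_nf at *
    rw [this, e3]
    ring
  rw [← this, Real.log_pow]
  push_cast
  ring

lemma aux_cosseries (r x : ℝ) (hr0 : 0 ≤ r) (hr1 : r < 1) :
    HasSum (fun n : ℕ => r ^ n * Real.cos (2 * π * n * x) / n)
      (-(Real.log ((1 - r) ^ 2 + 4 * r * Real.sin (π * x) ^ 2) / 2)) := by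
  have h := Complex.hasSum_taylorSeries_neg_log
    (z := (r : ℂ) * Complex.exp ((2 * π * x : ℝ) * Complex.I))
    (by rw [norm_mul, Complex.norm_exp_ofReal_mul_I]; simpa [abs_of_nonneg hr0] using hr1)
  have h2 := Complex.hasSum_re h
  rw [Complex.neg_re, Complex.log_re, aux_normSq] at h2
  convert! h2 using 1
  ext n
  rw [mul_pow, ← Complex.exp_nat_mul, Complex.div_natCast_re]
  have : (n : ℂ) * ((2 * π * x : ℝ) * Complex.I) = ((2 * π * n * x : ℝ) : ℂ) * Complex.I := by
    push_cast; ring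
  rw [this, ← Complex.ofReal_pow, Complex.re_ofReal_mul, Complex.exp_ofReal_mul_I_re]

lemma aux_intr (r : ℝ) (hr0 : 0 ≤ r) (hr1 : r < 1) :
    ∫ x in (0 : ℝ)..1, x ^ 2 * (-(Real.log ((1 - r) ^ 2 + 4 * r * Real.sin (π * x) ^ 2) / 2))
      = ∑' n : ℕ, r ^ n / (2 * π ^ 2 * n ^ 3) := by
  have key := intervalIntegral.hasSum_integral_of_dominated_convergence
    (μ := MeasureTheory.volume) (a := 0) (b := 1)
    (F := fun (n : ℕ) x => x ^ 2 * (r ^ n * Real.cos (2 * π * n * x) / n))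
    (f := fun x => x ^ 2 * (-(Real.log ((1 - r) ^ 2 + 4 * r * Real.sin (π * x) ^ 2) / 2)))
    (fun n _ => r ^ n)
    (fun n => (Continuous.aestronglyMeasurable (by fun_prop)))
    (fun n => Filter.Eventually.of_forall (by
      intro x hx
      rw [Set.uIoc_of_le zero_le_one] at hx
      have h1 : |x ^ 2| ≤ 1 := by
        rw [abs_of_nonneg (by positivity)]; nlinarith [hx.1, hx.2]
      have h2 := Real.abs_cos_le_one (2 * π * n * x)
      have h3 : |((n : ℝ))⁻¹| ≤ 1 := by
        rw [abs_of_nonneg (by positivity)]; exact Nat.cast_inv_le_one n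
      have h4 : 0 ≤ r ^ n := by positivity
      rw [Real.norm_eq_abs, abs_mul, div_eq_mul_inv, abs_mul, abs_mul, abs_of_nonneg h4]
      calc _ ≤ 1 * (r ^ n * 1 * 1) := by gcongr
        _ = r ^ n := by ring))
    (Filter.Eventually.of_forall fun x _ => summable_geometric_of_lt_one hr0 hr1)
    (by simp)
    (Filter.Eventually.of_forall fun x _ => (aux_cosseries r x hr0 hr1).mul_left _)
  rw [← key.tsum_eq]
  congr 1
  ext n
  by_cases hn : n = 0
  · simp [hn]
  · have : ∀ x : ℝ, x ^ 2 * (r ^ n * Real.cos (2 * π * n * x) / n)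
        = r ^ n / n * (x ^ 2 * Real.cos (2 * π * n * x)) := by intro x; ring
    simp_rw [this]
    rw [intervalIntegral.integral_const_mul, aux_intcos n hn]
    field_simp

lemma aux_logsin_int : IntervalIntegrable (fun x : ℝ => Real.log (Real.sin (π * x)))
    MeasureTheory.volume 0 1 := by
  have h := (intervalIntegrable_log_sin (a := 0) (b := π)).comp_mul_left (c := π)
  simpa [Real.pi_ne_zero] using h

lemma aux_logsin : ∫ x in (0 : ℝ)..1, x ^ 2 * Real.log (Real.sin (π * x))
    = - Real.log 2 / 3 - (∑' n : ℕ, 1 / (n : ℝ) ^ 3) / (2 * π ^ 2) := by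
  let l : Filter ℝ := nhdsWithin 1 (Set.Iio 1)
  have hl : ∀ᶠ r : ℝ in l, 1 / 4 ≤ r ∧ r < 1 := by
    have : Set.Ioo (1 / 4 : ℝ) 1 ∈ l := Ioo_mem_nhdsLT (by norm_num)
    filter_upwards [this] with r hr using ⟨hr.1.le, hr.2⟩
  have T1 : Filter.Tendsto (fun r : ℝ => ∑' n : ℕ, r ^ n / (2 * π ^ 2 * n ^ 3)) l
      (nhds (∑' n : ℕ, 1 / (2 * π ^ 2 * (n : ℝ) ^ 3))) := by
    refine tendsto_tsum_of_dominated_convergence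
      (bound := fun n : ℕ => 1 / (2 * π ^ 2 * (n : ℝ) ^ 3)) ?_ ?_ ?_
    · have := (Real.summable_one_div_nat_pow (p := 3).2 (by norm_num)).mul_left (1 / (2 * π ^ 2))
      convert! this using 2 with n
      rw [one_div_mul_one_div]
    · intro n
      have : Continuous fun r : ℝ => r ^ n / (2 * π ^ 2 * (n : ℝ) ^ 3) := by fun_prop
      have := (this.tendsto 1).mono_left (nhdsWithin_le_nhds (s := Set.Iio 1))
      simpa using this
    · filter_upwards [hl] with r hr n
      have h0 : 0 ≤ r := by linarith [hr.1]
      rw [Real.norm_of_nonneg (by positivity)]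
      gcongr
      exact pow_le_one₀ h0 hr.2.le
  have hnz : ∀ᵐ x : ℝ, x ∈ Set.uIoc (0 : ℝ) 1 → 0 < Real.sin (π * x) := by
    filter_upwards [MeasureTheory.Measure.ae_ne MeasureTheory.volume (1 : ℝ)] with x hx1 hx
    rw [Set.uIoc_of_le zero_le_one] at hx
    have hlt := lt_of_le_of_ne hx.2 hx1
    have := Real.pi_pos
    exact Real.sin_pos_of_pos_of_lt_pi (mul_pos this hx.1) (by nlinarith)
  have T2 : Filter.Tendsto (fun r : ℝ => ∫ x in (0 : ℝ)..1,
        x ^ 2 * (-(Real.log ((1 - r) ^ 2 + 4 * r * Real.sin (π * x) ^ 2) / 2))) l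
      (nhds (∫ x in (0 : ℝ)..1, x ^ 2 * (-(Real.log (4 * Real.sin (π * x) ^ 2) / 2)))) := by
    refine intervalIntegral.tendsto_integral_filter_of_dominated_convergence
      (fun x => Real.log 5 + |Real.log (Real.sin (π * x))|) ?_ ?_ ?_ ?_
    · refine Filter.Eventually.of_forall fun r => Measurable.aestronglyMeasurable ?_
      fun_prop
    · filter_upwards [hl] with r hr
      filter_upwards [hnz] with x hs hx
      have hs := hs hx
      rw [Set.uIoc_of_le zero_le_one] at hx
      have h1 : |x ^ 2| ≤ 1 := by
        rw [abs_of_nonneg (by positivity)]; nlinarith [hx.1, hx.2]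
      have hs1 := Real.sin_le_one (π * x)
      have hs2 : Real.sin (π * x) ^ 2 ≤ 1 := by nlinarith
      set s := Real.sin (π * x)
      have hA : s ^ 2 ≤ (1 - r) ^ 2 + 4 * r * s ^ 2 := by nlinarith [sq_nonneg (1 - r), sq_nonneg s, hr.1]
      have hB : (1 - r) ^ 2 + 4 * r * s ^ 2 ≤ 5 := by nlinarith [sq_nonneg s, hr.1, hr.2]
      have l1 := Real.log_le_log (by positivity) hA
      have l2 := Real.log_le_log (lt_of_lt_of_le (by positivity) hA) hB
      have l3 : Real.log (s ^ 2) = 2 * Real.log s := by rw [Real.log_pow]; norm_num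
      have l5 : 0 ≤ Real.log 5 := Real.log_nonneg (by norm_num)
      have l6 := neg_abs_le (Real.log s)
      have l7 := abs_nonneg (Real.log s)
      rw [Real.norm_eq_abs, abs_mul]
      have : |(-(Real.log ((1 - r) ^ 2 + 4 * r * s ^ 2) / 2))| ≤ Real.log 5 + |Real.log s| := by
        rw [abs_le]; constructor <;> linarith
      calc _ ≤ 1 * (Real.log 5 + |Real.log s|) := by gcongr
        _ = _ := one_mul _
    · exact (intervalIntegrable_const).add aux_logsin_int.abs
    · filter_upwards [hnz] with x hs hx
      have hs := hs hx
      have c : Filter.Tendsto (fun r : ℝ => (1 - r) ^ 2 + 4 * r * Real.sin (π * x) ^ 2) l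
          (nhds (4 * Real.sin (π * x) ^ 2)) := by
        have : Continuous fun r : ℝ => (1 - r) ^ 2 + 4 * r * Real.sin (π * x) ^ 2 := by fun_prop
        have := (this.tendsto 1).mono_left (nhdsWithin_le_nhds (s := Set.Iio 1))
        simpa using this
      exact (((c.log (by positivity)).div_const 2).neg).const_mul _
  have heq := tendsto_nhds_unique (T2.congr' (by
    filter_upwards [hl] with r hr
    exact aux_intr r (by linarith [hr.1]) hr.2)) T1
  have e1 : ∫ x in (0 : ℝ)..1, x ^ 2 * (-(Real.log (4 * Real.sin (π * x) ^ 2) / 2))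
      = ∫ x in (0 : ℝ)..1, (-(x ^ 2 * Real.log 2) - x ^ 2 * Real.log (Real.sin (π * x))) := by
    apply intervalIntegral.integral_congr_ae
    filter_upwards [hnz] with x hs hx
    have hs := hs hx
    have : 4 * Real.sin (π * x) ^ 2 = (2 * Real.sin (π * x)) ^ 2 := by ring
    rw [this, Real.log_pow, Real.log_mul two_ne_zero hs.ne']
    push_cast
    ring
  have i2 : IntervalIntegrable (fun x : ℝ => x ^ 2 * Real.log (Real.sin (π * x)))
      MeasureTheory.volume 0 1 :=
    aux_logsin_int.continuousOn_mul (Continuous.continuousOn (by fun_prop))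
  rw [e1, intervalIntegral.integral_sub (Continuous.intervalIntegrable (by fun_prop) _ _) i2,
    intervalIntegral.integral_neg, intervalIntegral.integral_mul_const, integral_pow] at heq
  have e2 : ∑' n : ℕ, 1 / (2 * π ^ 2 * (n : ℝ) ^ 3)
      = (∑' n : ℕ, 1 / (n : ℝ) ^ 3) / (2 * π ^ 2) := by
    rw [← tsum_div_const]
    congr 1
    ext n
    rw [div_div, mul_comm]
  rw [e2] at heq
  norm_num at heq ⊢
  linarith

theorem stmt8 :
    ∑' k : ℕ, riemannZeta (2 * ((k : ℂ) + 1)) / (((k : ℂ) + 1) * (2 * ((k : ℂ) + 1) + 3))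
      = -1 / 9 + Real.log (2 * π) / 3 + riemannZeta 3 / (2 * (π : ℂ) ^ 2) := by
  have hI : ∫ x in (0 : ℝ)..1, x ^ 2 * (Real.log (π * x) - Real.log (Real.sin (π * x)))
      = -1 / 9 + Real.log (2 * π) / 3 + (∑' n : ℕ, 1 / (n : ℝ) ^ 3) / (2 * π ^ 2) := by
    have i2 : IntervalIntegrable (fun x : ℝ => x ^ 2 * Real.log (Real.sin (π * x)))
        MeasureTheory.volume 0 1 :=
      aux_logsin_int.continuousOn_mul (Continuous.continuousOn (by fun_prop))
    have i3 : IntervalIntegrable (fun x : ℝ => x ^ 2 * Real.log x)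
        MeasureTheory.volume 0 1 :=
      intervalIntegral.intervalIntegrable_log'.continuousOn_mul
        (Continuous.continuousOn (by fun_prop))
    have i1 : IntervalIntegrable (fun x : ℝ => x ^ 2 * Real.log π)
        MeasureTheory.volume 0 1 := Continuous.intervalIntegrable (by fun_prop) _ _
    have e : ∫ x in (0 : ℝ)..1, x ^ 2 * (Real.log (π * x) - Real.log (Real.sin (π * x)))
        = ∫ x in (0 : ℝ)..1, ((x ^ 2 * Real.log π + x ^ 2 * Real.log x)
            - x ^ 2 * Real.log (Real.sin (π * x))) := by
      apply intervalIntegral.integral_congr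
      intro x _
      by_cases hx : x = 0
      · simp [hx]
      · simp only
        rw [Real.log_mul Real.pi_ne_zero hx]
        ring
    rw [e, intervalIntegral.integral_sub (i1.add i3) i2, intervalIntegral.integral_add i1 i3,
      aux_intlog, aux_logsin, intervalIntegral.integral_mul_const, integral_pow,
      Real.log_mul two_ne_zero Real.pi_ne_zero]
    norm_num
    ring
  have h := aux_lhs.tsum_eq
  rw [hI] at h
  have hz := aux_zeta_nat 3 (by norm_num)
  have h' := congrArg (fun t : ℝ => (t : ℂ)) h
  simp_rw [auxZ_eq]
  have e3 : ((3 : ℕ) : ℂ) = 3 := by norm_num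
  rw [e3] at hz
  rw [hz]
  simp only [Complex.ofReal_tsum] at h' ⊢
  push_cast at h' ⊢
  simpa using h'
end

section
/- ∑_{k=1}^∞ ζ(2k)/(4^k k(2k+3)) = −1/9 + ln(π)/3 − 3ζ(3)/(2π²). -/
open Real Complex

noncomputable def zz (m : ℕ) : ℝ := ∑' n : ℕ, 1 / (n : ℝ) ^ m

lemma zz_zeta {m : ℕ} (hm : 1 < m) : riemannZeta m = (zz m : ℂ) := by
  rw [zeta_nat_eq_tsum_of_gt_one hm, zz, Complex.ofReal_tsum]
  push_cast
  rfl

lemma zz_summable {m : ℕ} (hm : 1 < m) : Summable (fun n : ℕ => 1 / (n : ℝ) ^ m) :=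
  Real.summable_one_div_nat_pow.mpr hm

lemma zz_shift {m : ℕ} (hm : 1 < m) :
    HasSum (fun n : ℕ => 1 / ((n : ℝ) + 1) ^ m) (zz m) := by
  have h := (zz_summable hm).tsum_eq_zero_add
  have h2 := ((summable_nat_add_iff 1).mpr (zz_summable hm)).hasSum
  have h0 : (1 : ℝ) / ((0 : ℕ) : ℝ) ^ m = 0 := by
    rw [Nat.cast_zero, zero_pow (by omega), div_zero]
  rw [h0, zero_add] at h
  rw [zz, h]
  simpa using h2

lemma zz_nonneg (m : ℕ) : 0 ≤ zz m := tsum_nonneg fun n => by positivity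

lemma zz_le {m : ℕ} (hm : 2 ≤ m) : zz m ≤ zz 2 := by
  refine hasSum_le (fun n => ?_) (zz_shift (by omega)) (zz_shift one_lt_two)
  apply one_div_le_one_div_of_le (by positivity)
  apply pow_le_pow_right₀ _ hm
  have : (0 : ℝ) ≤ n := by positivity
  linarith

lemma euler_log {x : ℝ} (h0 : 0 < x) (h1 : x < 1) :
    HasSum (fun n : ℕ => -Real.log (1 - x ^ 2 / ((n : ℝ) + 1) ^ 2))
      (Real.log (π * x) - Real.log (Real.sin (π * x))) := by
  have hlt : ∀ n : ℕ, x ^ 2 / ((n : ℝ) + 1) ^ 2 < 1 := fun n => by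
    rw [div_lt_one (by positivity)]
    apply pow_lt_pow_left₀ _ h0.le (by norm_num)
    have : (0 : ℝ) ≤ n := by positivity
    linarith
  have hpos : ∀ n : ℕ, 0 < 1 - x ^ 2 / ((n : ℝ) + 1) ^ 2 := fun n => sub_pos.mpr (hlt n)
  have hs : 0 < Real.sin (π * x) := by
    apply Real.sin_pos_of_pos_of_lt_pi (by positivity)
    nlinarith [Real.pi_pos]
  rw [hasSum_iff_tendsto_nat_of_nonneg]
  · have h := ((Real.continuousAt_log hs.ne').tendsto.comp
      (Real.tendsto_euler_sin_prod x)).const_sub (Real.log (π * x))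
    refine h.congr fun n => ?_
    simp only [Function.comp_apply]
    rw [Real.log_mul (by positivity) (Finset.prod_ne_zero_iff.mpr fun j _ => (hpos j).ne'),
      Real.log_prod (fun j _ => (hpos j).ne'), Finset.sum_neg_distrib]
    ring
  · intro n
    have := Real.log_nonpos (hpos n).le (by
      have : 0 ≤ x ^ 2 / ((n : ℝ) + 1) ^ 2 := by positivity
      linarith)
    linarith

lemma zeta_gen {x : ℝ} (h0 : 0 < x) (h1 : x < 1) :
    HasSum (fun k : ℕ => zz (2 * (k + 1)) / (k + 1) * (x ^ 2) ^ (k + 1))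
      (Real.log (π * x) - Real.log (Real.sin (π * x))) := by
  have hE := euler_log h0 h1
  have hin : ∀ n : ℕ, HasSum (fun k : ℕ => (x ^ 2 / ((n : ℝ) + 1) ^ 2) ^ (k + 1) / ((k : ℝ) + 1))
      (-Real.log (1 - x ^ 2 / ((n : ℝ) + 1) ^ 2)) := fun n => by
    apply Real.hasSum_pow_div_log_of_abs_lt_one
    rw [abs_of_nonneg (by positivity), div_lt_one (by positivity)]
    apply pow_lt_pow_left₀ _ h0.le (by norm_num)
    have : (0 : ℝ) ≤ n := by positivity
    linarith
  let f : ℕ × ℕ → ℝ := fun p => (x ^ 2 / ((p.1 : ℝ) + 1) ^ 2) ^ (p.2 + 1) / ((p.2 : ℝ) + 1)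
  have hf : Summable f := by
    rw [summable_prod_of_nonneg (fun p => by simp only [f, Pi.zero_apply]; positivity)]
    refine ⟨fun n => (hin n).summable, ?_⟩
    refine hE.summable.congr fun n => ?_
    exact ((hin n).tsum_eq).symm
  have hf1 : HasSum f (Real.log (π * x) - Real.log (Real.sin (π * x))) := by
    have := hf.hasSum
    rwa [(this.prod_fiberwise hin).unique hE] at this
  have hf2 := (Equiv.prodComm ℕ ℕ).hasSum_iff.mpr hf1
  refine hf2.prod_fiberwise fun k => ?_
  have := (zz_shift (m := 2 * (k + 1)) (by omega)).mul_left ((x ^ 2) ^ (k + 1) / ((k : ℝ) + 1))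
  convert! this using 1
  · ext n
    change (x ^ 2 / ((n : ℝ) + 1) ^ 2) ^ (k + 1) / ((k : ℝ) + 1) = _
    rw [div_pow, ← pow_mul, ← pow_mul]
    field_simp
  · ring

lemma int_log : ∫ x in (0 : ℝ)..(π / 2), x ^ 2 * Real.log x =
    (π / 2) ^ 3 / 3 * Real.log (π / 2) - (π / 2) ^ 3 / 9 := by
  have hc : Continuous fun x : ℝ => x * Real.log x := Real.continuous_mul_log
  rw [intervalIntegral.integral_eq_sub_of_hasDerivAt_of_le
    (f := fun x => x ^ 2 / 3 * (x * Real.log x) - x ^ 3 / 9) (by positivity)]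
  · simp; ring
  · exact Continuous.continuousOn (by fun_prop)
  · intro x hx
    have hx0 : x ≠ 0 := hx.1.ne'
    have := (((hasDerivAt_pow 2 x).div_const 3).mul
      ((hasDerivAt_id x).mul (Real.hasDerivAt_log hx0))).sub ((hasDerivAt_pow 3 x).div_const 9)
    convert! this using 1
    simp
    field_simp
    ring
  · have : Continuous fun x : ℝ => x * (x * Real.log x) := by fun_prop
    refine (this.congr fun x => ?_).intervalIntegrable _ _
    ring

noncomputable def vv (n : ℕ) (x : ℝ) : ℝ :=
  ∑ j ∈ Finset.range n, 2 * Real.cos ((2 * j + 1) * x)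

lemma vv_cont (n : ℕ) : Continuous (vv n) := by
  unfold vv; fun_prop

lemma vv_sin (n : ℕ) (x : ℝ) : Real.sin (2 * n * x) = Real.sin x * vv n x := by
  induction n with
  | zero => simp [vv]
  | succ n ih =>
    have : vv (n + 1) x = vv n x + 2 * Real.cos ((2 * n + 1) * x) := by
      simp [vv, Finset.sum_range_succ]
    rw [this, mul_add, ← ih]
    have e1 : 2 * ((n + 1 : ℕ) : ℝ) * x = (2 * n + 1) * x + x := by push_cast; ring
    have e2 : 2 * (n : ℝ) * x = (2 * n + 1) * x - x := by ring
    rw [e1, e2, Real.sin_add, Real.sin_sub]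
    ring

lemma int_cos (j : ℕ) (hj : j ≠ 0) : ∫ x in (0 : ℝ)..(π / 2), Real.cos (2 * j * x) = 0 := by
  have hj' : (2 * (j : ℝ)) ≠ 0 := by positivity
  rw [intervalIntegral.integral_comp_mul_left (fun y => Real.cos y) hj', integral_cos]
  have : 2 * (j : ℝ) * (π / 2) = j * π := by ring
  rw [this, Real.sin_nat_mul_pi]
  simp

lemma int_vv (n : ℕ) : ∫ x in (0 : ℝ)..(π / 2), vv (n + 1) x * Real.cos x = π / 2 := by
  induction n with
  | zero =>
    have : ∀ x : ℝ, vv (0 + 1) x * Real.cos x = 1 + Real.cos (2 * (1 : ℕ) * x) := fun x => by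
      simp [vv, Real.cos_two_mul]; ring
    simp_rw [this]
    rw [intervalIntegral.integral_add (by simp)
      (Continuous.intervalIntegrable (by fun_prop) _ _), int_cos 1 one_ne_zero]
    simp
  | succ n ih =>
    have : ∀ x : ℝ, vv (n + 1 + 1) x * Real.cos x = vv (n + 1) x * Real.cos x +
        (Real.cos (2 * (n + 2 : ℕ) * x) + Real.cos (2 * (n + 1 : ℕ) * x)) := fun x => by
      have : vv (n + 1 + 1) x = vv (n + 1) x + 2 * Real.cos ((2 * (n + 1 : ℕ) + 1) * x) := by
        rw [vv, Finset.sum_range_succ]; rfl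
      rw [this]
      have e1 : 2 * ((n + 2 : ℕ) : ℝ) * x = (2 * (n + 1 : ℕ) + 1) * x + x := by push_cast; ring
      have e2 : 2 * ((n + 1 : ℕ) : ℝ) * x = (2 * (n + 1 : ℕ) + 1) * x - x := by ring
      rw [e1, e2, Real.cos_add, Real.cos_sub]
      ring
    simp_rw [this]
    have hv := vv_cont (n + 1)
    rw [intervalIntegral.integral_add (Continuous.intervalIntegrable (by fun_prop) _ _)
      (Continuous.intervalIntegrable (by fun_prop) _ _),
      intervalIntegral.integral_add (Continuous.intervalIntegrable (by fun_prop) _ _)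
      (Continuous.intervalIntegrable (by fun_prop) _ _), ih, int_cos _ (by omega),
      int_cos _ (by omega)]
    simp

lemma int_coslog (n : ℕ) (hn : n ≠ 0) :
    ∫ x in (0 : ℝ)..(π / 2), Real.cos (2 * n * x) * Real.log (Real.sin x) = -π / (4 * n) := by
  obtain ⟨m, rfl⟩ := Nat.exists_eq_succ_of_ne_zero hn
  set n := m.succ with hnn
  have hn0 : (n : ℝ) ≠ 0 := by positivity
  have hL : IntervalIntegrable (fun x => Real.log (Real.sin x)) MeasureTheory.volume 0 (π / 2) :=
    intervalIntegrable_log_sin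
  have h1 : IntervalIntegrable (fun x => Real.cos (2 * n * x) * Real.log (Real.sin x))
      MeasureTheory.volume 0 (π / 2) :=
    hL.continuousOn_mul (Continuous.continuousOn (by fun_prop))
  have hv := vv_cont n
  have h2 : IntervalIntegrable (fun x => vv n x * Real.cos x / (2 * n))
      MeasureTheory.volume 0 (π / 2) := Continuous.intervalIntegrable (by fun_prop) _ _
  have hc : Continuous fun x : ℝ => Real.sin x * Real.log (Real.sin x) :=
    Real.continuous_mul_log.comp Real.continuous_sin
  have key := intervalIntegral.integral_eq_sub_of_hasDerivAt_of_le (a := 0) (b := π / 2)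
    (f := fun x => vv n x * (Real.sin x * Real.log (Real.sin x)) / (2 * n))
    (f' := fun x => Real.cos (2 * n * x) * Real.log (Real.sin x) + vv n x * Real.cos x / (2 * n))
    (by positivity) (Continuous.continuousOn (by fun_prop)) (by
      intro x hx
      have hs : Real.sin x ≠ 0 :=
        (Real.sin_pos_of_pos_of_lt_pi hx.1 (by linarith [hx.2, Real.pi_pos])).ne'
      have hd : HasDerivAt (fun x => Real.sin (2 * n * x) * Real.log (Real.sin x) / (2 * n))
          ((Real.cos (2 * n * x) * (2 * n * 1) * Real.log (Real.sin x) +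
            Real.sin (2 * n * x) * (Real.cos x / Real.sin x)) / (2 * n)) x :=
        ((((hasDerivAt_id x).const_mul (2 * (n : ℝ))).sin).mul
          ((Real.hasDerivAt_sin x).log hs)).div_const _
      convert! hd using 1
      · ext y
        rw [vv_sin]; ring
      · rw [vv_sin]; field_simp) (h1.add h2)
  rw [intervalIntegral.integral_add h1 h2, intervalIntegral.integral_div, int_vv] at key
  simp at key
  rw [eq_neg_of_add_eq_zero_left key]
  field_simp
  norm_num

lemma fourier_sq {x : ℝ} (h0 : 0 ≤ x) (h1 : x ≤ π / 2) :
    HasSum (fun n : ℕ => (-1) ^ n / (n : ℝ) ^ 2 * Real.cos (2 * n * x)) (x ^ 2 - π ^ 2 / 12) := by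
  have hp := Real.pi_pos
  have h := hasSum_one_div_nat_pow_mul_cos one_ne_zero (x := 1 / 2 + x / π)
    ⟨by positivity, by
      have : x / π ≤ 1 / 2 := by rw [div_le_iff₀ hp]; linarith
      linarith⟩
  have hb := bernoulliFun_two (1 / 2 + x / π)
  rw [bernoulliFun] at hb
  rw [mul_one, hb] at h
  convert! h using 1
  · ext n
    have : 2 * π * n * (1 / 2 + x / π) = 2 * n * x + n * π := by field_simp; ring
    rw [this, Real.cos_add_nat_mul_pi]
    ring
  · simp [Nat.factorial]
    field_simp
    ring

lemma alt_three : HasSum (fun n : ℕ => (-1) ^ n / (n : ℝ) ^ 3) (-(3 / 4) * zz 3) := by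
  have hs := zz_summable (m := 3) (by norm_num)
  have he : HasSum (fun k : ℕ => 1 / ((2 * k : ℕ) : ℝ) ^ 3) (zz 3 / 8) := by
    convert! hs.hasSum.div_const 8 using 1
    ext k; push_cast; rw [mul_pow]; norm_num; ring
  have ho : HasSum (fun k : ℕ => 1 / ((2 * k + 1 : ℕ) : ℝ) ^ 3) (7 * zz 3 / 8) := by
    have hso : Summable (fun k : ℕ => 1 / ((2 * k + 1 : ℕ) : ℝ) ^ 3) :=
      hs.comp_injective (i := fun k : ℕ => 2 * k + 1) (fun a b h => by simpa using h)
    have := (he.even_add_odd (f := fun n : ℕ => 1 / (n : ℝ) ^ 3) hso.hasSum).unique hs.hasSum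
    have e : ∑' k : ℕ, 1 / ((2 * k + 1 : ℕ) : ℝ) ^ 3 = 7 * zz 3 / 8 := by
      change _ = zz 3 at this
      linarith
    rw [← e]; exact hso.hasSum
  have h := HasSum.even_add_odd (f := fun n : ℕ => (-1 : ℝ) ^ n / (n : ℝ) ^ 3)
    (m := zz 3 / 8) (m' := -(7 * zz 3 / 8)) (by
      convert! he using 1
      ext k; simp) (by
      convert! ho.neg using 1
      ext k; rw [pow_succ, pow_mul]; norm_num; ring)
  convert h using 1
  ring

lemma int_sqlog : ∫ x in (0 : ℝ)..(π / 2), x ^ 2 * Real.log (Real.sin x) =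
    -π ^ 3 * Real.log 2 / 24 + 3 * π / 16 * zz 3 := by
  have hp := Real.pi_pos
  have hL : IntervalIntegrable (fun x => Real.log (Real.sin x)) MeasureTheory.volume 0 (π / 2) :=
    intervalIntegrable_log_sin
  have h := intervalIntegral.hasSum_integral_of_dominated_convergence
    (μ := MeasureTheory.volume) (a := 0) (b := π / 2)
    (F := fun (n : ℕ) x => (-1) ^ n / (n : ℝ) ^ 2 * (Real.cos (2 * n * x) * Real.log (Real.sin x)))
    (f := fun x => (x ^ 2 - π ^ 2 / 12) * Real.log (Real.sin x))
    (fun (n : ℕ) x => 1 / (n : ℝ) ^ 2 * |Real.log (Real.sin x)|)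
    (fun n => by
      apply Measurable.aestronglyMeasurable
      fun_prop)
    (fun n => Filter.Eventually.of_forall fun x _ => by
      rw [Real.norm_eq_abs, abs_mul, abs_mul, abs_div, abs_pow, abs_neg, abs_one, one_pow, abs_pow,
        Nat.abs_cast]
      gcongr
      exact mul_le_of_le_one_left (abs_nonneg _) (Real.abs_cos_le_one _))
    (Filter.Eventually.of_forall fun x _ => (zz_summable one_lt_two).mul_right _)
    (by
      simp_rw [tsum_mul_right]
      exact hL.abs.const_mul _)
    (Filter.Eventually.of_forall fun x hx => by
      rw [Set.uIoc_of_le (by positivity)] at hx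
      convert! (fourier_sq hx.1.le hx.2).mul_right (Real.log (Real.sin x)) using 1
      ext n; ring)
  have h2 : HasSum (fun n : ℕ => (-(π / 4)) * ((-1) ^ n / (n : ℝ) ^ 3))
      (-(π / 4) * (-(3 / 4) * zz 3)) := alt_three.mul_left _
  have e := h.unique (by
    convert! h2 using 1
    ext n
    rw [intervalIntegral.integral_const_mul]
    rcases eq_or_ne n 0 with rfl | hn
    · simp
    · rw [int_coslog n hn]
      field_simp)
  have e2 : ∫ x in (0 : ℝ)..(π / 2), (x ^ 2 - π ^ 2 / 12) * Real.log (Real.sin x) =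
      (∫ x in (0 : ℝ)..(π / 2), x ^ 2 * Real.log (Real.sin x)) -
        π ^ 2 / 12 * ∫ x in (0 : ℝ)..(π / 2), Real.log (Real.sin x) := by
    rw [← intervalIntegral.integral_const_mul, ← intervalIntegral.integral_sub
      (hL.continuousOn_mul (Continuous.continuousOn (by fun_prop))) (hL.const_mul _)]
    congr 1; ext x; ring
  rw [e2, integral_log_sin_zero_pi_div_two] at e
  linear_combination e

lemma main_sum : HasSum (fun k : ℕ => (π / 2) ^ 3 * (zz (2 * (k + 1)) /
      (4 ^ (k + 1) * ((k : ℝ) + 1) * (2 * ((k : ℝ) + 1) + 3))))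
    (∫ x in (0 : ℝ)..(π / 2), (x ^ 2 * Real.log x - x ^ 2 * Real.log (Real.sin x))) := by
  have hp := Real.pi_pos
  have h := intervalIntegral.hasSum_integral_of_dominated_convergence
    (μ := MeasureTheory.volume) (a := 0) (b := π / 2)
    (F := fun (k : ℕ) x => zz (2 * (k + 1)) / (k + 1) * ((x / π) ^ 2) ^ (k + 1) * x ^ 2)
    (f := fun x => x ^ 2 * Real.log x - x ^ 2 * Real.log (Real.sin x))
    (fun (k : ℕ) x => zz 2 * (1 / 4) ^ (k + 1) * (π / 2) ^ 2)
    (fun n => by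
      apply Continuous.aestronglyMeasurable
      fun_prop)
    (fun k => Filter.Eventually.of_forall fun x hx => by
      rw [Set.uIoc_of_le (by positivity)] at hx
      have hx0 := hx.1
      have hz := zz_nonneg (2 * (k + 1))
      have hz2 := zz_nonneg 2
      rw [Real.norm_eq_abs, abs_of_nonneg (by positivity)]
      have a1 : zz (2 * (k + 1)) / (k + 1) ≤ zz 2 := by
        apply (div_le_self hz (by
          have : (0 : ℝ) ≤ k := by positivity
          linarith)).trans (zz_le (by omega))
      have a2 : (x / π) ^ 2 ≤ 1 / 4 := by
        have : x / π ≤ 1 / 2 := by rw [div_le_iff₀ hp]; linarith [hx.2]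
        have h3 : 0 ≤ x / π := by positivity
        nlinarith
      have a3 := hx.2
      gcongr)
    (Filter.Eventually.of_forall fun x _ => by
      have := (summable_nat_add_iff 1).mpr
        (summable_geometric_of_lt_one (r := (1 / 4 : ℝ)) (by norm_num) (by norm_num))
      exact (this.mul_left _).mul_right _)
    (by simp)
    (Filter.Eventually.of_forall fun x hx => by
      rw [Set.uIoc_of_le (by positivity)] at hx
      have g := (zeta_gen (x := x / π) (div_pos hx.1 hp)
        (by rw [div_lt_one hp]; linarith [hx.2])).mul_right (x ^ 2)
      rw [mul_div_cancel₀ _ hp.ne'] at g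
      convert! g using 1
      ring)
  convert! h using 1
  ext k
  have : ∀ x : ℝ, zz (2 * (k + 1)) / (k + 1) * ((x / π) ^ 2) ^ (k + 1) * x ^ 2 =
      zz (2 * (k + 1)) / (k + 1) / π ^ (2 * (k + 1)) * x ^ (2 * (k + 1) + 2) := fun x => by
    rw [← pow_mul, div_pow, pow_add]; ring
  simp_rw [this]
  rw [intervalIntegral.integral_const_mul, integral_pow]
  have e4 : (4 : ℝ) ^ (k + 1) = 2 ^ (2 * (k + 1)) := by rw [pow_mul]; norm_num
  rw [e4]
  have : (π / 2) ^ (2 * (k + 1) + 2 + 1) = π ^ (2 * (k + 1)) / 2 ^ (2 * (k + 1)) * (π / 2) ^ 3 := by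
    rw [add_assoc, pow_add, div_pow]
  rw [this]
  have hd : (2 * ((k : ℝ) + 1) + 3) ≠ 0 := by positivity
  have hd2 : ((2 * (k + 1) + 2 : ℕ) : ℝ) + 1 = 2 * ((k : ℝ) + 1) + 3 := by push_cast; ring
  rw [hd2]
  simp only [zero_pow (Nat.succ_ne_zero _), sub_zero]
  field_simp

lemma real_sum : HasSum (fun k : ℕ => zz (2 * (k + 1)) /
      (4 ^ (k + 1) * ((k : ℝ) + 1) * (2 * ((k : ℝ) + 1) + 3)))
    (-1 / 9 + Real.log π / 3 - 3 * zz 3 / (2 * π ^ 2)) := by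
  have hp := Real.pi_pos
  have h := main_sum.mul_left (((π / 2) ^ 3)⁻¹)
  have hL : IntervalIntegrable (fun x => Real.log (Real.sin x)) MeasureTheory.volume 0 (π / 2) :=
    intervalIntegrable_log_sin
  have hl : IntervalIntegrable (fun x => Real.log x) MeasureTheory.volume 0 (π / 2) :=
    intervalIntegral.intervalIntegrable_log'
  rw [intervalIntegral.integral_sub
    (hl.continuousOn_mul (Continuous.continuousOn (by fun_prop)))
    (hL.continuousOn_mul (Continuous.continuousOn (by fun_prop))), int_log, int_sqlog,
    Real.log_div hp.ne' two_ne_zero] at h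
  convert! h using 1
  · ext k
    rw [inv_mul_cancel_left₀ (by positivity)]
  · field_simp
    ring

theorem stmt12 :
    ∑' k : ℕ, riemannZeta (2 * ((k : ℂ) + 1))
        / ((4 : ℂ) ^ (k + 1) * ((k : ℂ) + 1) * (2 * ((k : ℂ) + 1) + 3))
      = -1 / 9 + Real.log π / 3 - 3 * riemannZeta 3 / (2 * (π : ℂ) ^ 2) := by
  have h := Complex.hasSum_ofReal.mpr real_sum
  have h3 : riemannZeta 3 = (zz 3 : ℂ) := by
    simpa using zz_zeta (m := 3) (by norm_num)
  rw [h3]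
  have e := h.tsum_eq
  push_cast at e
  rw [← e]
  refine tsum_congr fun k => ?_
  rw [← zz_zeta (m := 2 * (k + 1)) (by omega)]
  push_cast
  rfl
end
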